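/- For every positive integer n with n ≠ 2 there exists a prime number p in the interval [7n, 8n], i.e., with 7n ≤ p ≤ 8n. -/

import Mathlib

/-- The step function attached to a Chebyshev-type combination of factorials. -/
def stepF (q : ℕ) : ℤ :=
  ((q / 7 : ℕ) : ℤ) - ((q / 8 : ℕ) : ℤ) - ((q / 14 : ℕ) : ℤ) + ((q / 16 : ℕ) : ℤ) - ((q /
    21 : ℕ) : ℤ) + ((q / 24 : ℕ) : ℤ) - ((q / 35 : ℕ) : ℤ) + ((q / 40 : ℕ) : ℤ) - ((q / 48 :
    ℕ) : ℤ) + ((q / 56 : ℕ) : ℤ) - ((q / 80 : ℕ) : ℤ) + ((q / 84 : ℕ) : ℤ) + ((q / 105 : ℕ) :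
    ℤ) - ((q / 112 : ℕ) : ℤ) - ((q / 120 : ℕ) : ℤ) + 2 * ((q / 140 : ℕ) : ℤ) - ((q / 168 : ℕ)
    : ℤ) + ((q / 240 : ℕ) : ℤ) - 2 * ((q / 280 : ℕ) : ℤ) + ((q / 336 : ℕ) : ℤ) + ((q / 560 :
    ℕ) : ℤ) + 2 * ((q / 840 : ℕ) : ℤ) - ((q / 1680 : ℕ) : ℤ)

theorem stepF_period (k r : ℕ) : stepF (1680 * k + r) = stepF r := by
  unfold stepF
  have h7 : (1680 * k + r) / 7 = 240 * k + r / 7 := by omega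
  have h8 : (1680 * k + r) / 8 = 210 * k + r / 8 := by omega
  have h14 : (1680 * k + r) / 14 = 120 * k + r / 14 := by omega
  have h16 : (1680 * k + r) / 16 = 105 * k + r / 16 := by omega
  have h21 : (1680 * k + r) / 21 = 80 * k + r / 21 := by omega
  have h24 : (1680 * k + r) / 24 = 70 * k + r / 24 := by omega
  have h35 : (1680 * k + r) / 35 = 48 * k + r / 35 := by omega
  have h40 : (1680 * k + r) / 40 = 42 * k + r / 40 := by omega
  have h48 : (1680 * k + r) / 48 = 35 * k + r / 48 := by omega
  have h56 : (1680 * k + r) / 56 = 30 * k + r / 56 := by omega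
  have h80 : (1680 * k + r) / 80 = 21 * k + r / 80 := by omega
  have h84 : (1680 * k + r) / 84 = 20 * k + r / 84 := by omega
  have h105 : (1680 * k + r) / 105 = 16 * k + r / 105 := by omega
  have h112 : (1680 * k + r) / 112 = 15 * k + r / 112 := by omega
  have h120 : (1680 * k + r) / 120 = 14 * k + r / 120 := by omega
  have h140 : (1680 * k + r) / 140 = 12 * k + r / 140 := by omega
  have h168 : (1680 * k + r) / 168 = 10 * k + r / 168 := by omega
  have h240 : (1680 * k + r) / 240 = 7 * k + r / 240 := by omega
  have h280 : (1680 * k + r) / 280 = 6 * k + r / 280 := by omega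
  have h336 : (1680 * k + r) / 336 = 5 * k + r / 336 := by omega
  have h560 : (1680 * k + r) / 560 = 3 * k + r / 560 := by omega
  have h840 : (1680 * k + r) / 840 = 2 * k + r / 840 := by omega
  have h1680 : (1680 * k + r) / 1680 = 1 * k + r / 1680 := by omega
  rw [h7, h8, h14, h16, h21, h24, h35, h40, h48, h56, h80, h84, h105, h112, h120, h140, h168,
    h240, h280, h336, h560, h840, h1680]
  push_cast
  ring

theorem stepF_small : ∀ r < 1680,
    stepF r ≤ (if r = 7 then 1 else 0) + (if 756 ≤ r then 1 else 0) := by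
  decide +kernel

theorem stepF_le (q : ℕ) :
    stepF q ≤ (if q = 7 then 1 else 0) + (if 756 ≤ q then 1 else 0) := by
  have h := stepF_small (q % 1680) (Nat.mod_lt _ (by norm_num))
  have h2 := stepF_period (q / 1680) (q % 1680)
  rw [Nat.div_add_mod] at h2
  rw [h2]
  rcases Nat.lt_or_ge q 1680 with hq | hq
  · rwa [Nat.mod_eq_of_lt hq] at h ⊢
  · have : stepF (q % 1680) ≤ 1 := by
      refine h.trans ?_
      split_ifs <;> omega
    have h3 : 756 ≤ q := by omega
    rw [if_pos h3]
    split_ifs <;> omega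

/-- The Legendre formula in logarithmic form. -/
theorem log_factorial_eq (M k : ℕ) (h : k ≤ M) :
    Real.log (k.factorial : ℝ) =
      ∑ m ∈ Finset.Ioc 0 M, ArithmeticFunction.vonMangoldt m * ((k / m : ℕ) : ℝ) := by
  induction k with
  | zero => simp
  | succ k ih =>
    rw [Nat.factorial_succ, Nat.cast_mul, Real.log_mul (by positivity) (by positivity),
      ih (by omega), ← ArithmeticFunction.vonMangoldt_sum]
    have h1 : ∑ i ∈ (k + 1).divisors, ArithmeticFunction.vonMangoldt i =
        ∑ m ∈ Finset.Ioc 0 M, ArithmeticFunction.vonMangoldt m *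
          (if m ∣ k + 1 then (1 : ℝ) else 0) := by
      simp only [mul_ite, mul_one, mul_zero]
      rw [← Finset.sum_filter]
      refine Finset.sum_congr ?_ fun _ _ => rfl
      ext m
      simp only [Nat.mem_divisors, Finset.mem_filter, Finset.mem_Ioc]
      constructor
      · rintro ⟨hd, -⟩
        exact ⟨⟨Nat.pos_of_dvd_of_pos hd (by omega),
          (Nat.le_of_dvd (by omega) hd).trans h⟩, hd⟩
      · rintro ⟨-, hd⟩
        exact ⟨hd, by omega⟩
    rw [h1, ← Finset.sum_add_distrib]
    refine Finset.sum_congr rfl fun m _ => ?_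
    rw [Nat.succ_div]
    push_cast
    ring

theorem comb_eq (N : ℕ) :
    Real.log ((N / 7).factorial : ℝ) - Real.log ((N / 8).factorial : ℝ) - Real.log ((N /
    14).factorial : ℝ) + Real.log ((N / 16).factorial : ℝ) - Real.log ((N / 21).factorial :
    ℝ) + Real.log ((N / 24).factorial : ℝ) - Real.log ((N / 35).factorial : ℝ) + Real.log ((N
    / 40).factorial : ℝ) - Real.log ((N / 48).factorial : ℝ) + Real.log ((N / 56).factorial :
    ℝ) - Real.log ((N / 80).factorial : ℝ) + Real.log ((N / 84).factorial : ℝ) + Real.log ((N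
    / 105).factorial : ℝ) - Real.log ((N / 112).factorial : ℝ) - Real.log ((N /
    120).factorial : ℝ) + 2 * Real.log ((N / 140).factorial : ℝ) - Real.log ((N /
    168).factorial : ℝ) + Real.log ((N / 240).factorial : ℝ) - 2 * Real.log ((N /
    280).factorial : ℝ) + Real.log ((N / 336).factorial : ℝ) + Real.log ((N / 560).factorial
    : ℝ) + 2 * Real.log ((N / 840).factorial : ℝ) - Real.log ((N / 1680).factorial : ℝ) =
      ∑ m ∈ Finset.Ioc 0 N, ArithmeticFunction.vonMangoldt m * (stepF (N / m) : ℝ) := by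
  have key : ∀ d : ℕ, Real.log ((N / d).factorial : ℝ) =
      ∑ m ∈ Finset.Ioc 0 N, ArithmeticFunction.vonMangoldt m * ((N / m / d : ℕ) : ℝ) := by
    intro d
    rw [log_factorial_eq N (N / d) (Nat.div_le_self _ _)]
    refine Finset.sum_congr rfl fun m _ => ?_
    rw [Nat.div_div_eq_div_mul, Nat.div_div_eq_div_mul, mul_comm d m]
  simp only [key, Finset.mul_sum, ← Finset.sum_add_distrib, ← Finset.sum_sub_distrib]
  refine Finset.sum_congr rfl fun m _ => ?_
  unfold stepF
  simp only [Int.cast_add, Int.cast_sub, Int.cast_mul, Int.cast_natCast, Int.cast_ofNat]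
  ring

theorem log_factorial_upper (k : ℕ) (hk : 1 ≤ k) :
    Real.log (k.factorial : ℝ) ≤ k * Real.log k - k + Real.log k + 1 := by
  induction k, hk using Nat.le_induction with
  | base => simp
  | succ k hk ih =>
    have hk0 : (0 : ℝ) < k := by exact_mod_cast hk
    rw [Nat.factorial_succ, Nat.cast_mul, Real.log_mul (by positivity) (by positivity)]
    push_cast
    have h := Real.one_sub_inv_le_log_of_pos (x := ((k : ℝ) + 1) / k) (by positivity)
    rw [Real.log_div (by positivity) (by positivity), inv_div] at h
    have h2 : 1 ≤ ((k : ℝ) + 1) * (Real.log (k + 1) - Real.log k) := by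
      calc (1 : ℝ) = ((k : ℝ) + 1) * (1 - k / (k + 1)) := by field_simp; ring
        _ ≤ _ := by gcongr
    linarith

theorem log_factorial_lower (k : ℕ) (hk : 1 ≤ k) :
    k * Real.log k - k ≤ Real.log (k.factorial : ℝ) := by
  induction k, hk using Nat.le_induction with
  | base => simp
  | succ k hk ih =>
    have hk0 : (0 : ℝ) < k := by exact_mod_cast hk
    rw [Nat.factorial_succ, Nat.cast_mul, Real.log_mul (by positivity) (by positivity)]
    push_cast
    have h := Real.log_le_sub_one_of_pos (x := ((k : ℝ) + 1) / k) (by positivity)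
    rw [Real.log_div (by positivity) (by positivity)] at h
    have h2 : (k : ℝ) * (Real.log (k + 1) - Real.log k) ≤ 1 := by
      calc _ ≤ (k : ℝ) * (((k : ℝ) + 1) / k - 1) := by gcongr
        _ = 1 := by field_simp; ring
    linarith

/-- Stirling bounds for the factorial of an integer quotient. -/
theorem stirling_div (N d : ℕ) (hd : 1 ≤ d) (hN : d ≤ N) :
    (N : ℝ) / d * (Real.log N - Real.log d - 1) - (Real.log N + 1)
        ≤ Real.log ((N / d).factorial : ℝ) ∧
      Real.log ((N / d).factorial : ℝ)
        ≤ (N : ℝ) / d * (Real.log N - Real.log d - 1) + (Real.log N + 1) := by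
  have hd0 : (0 : ℝ) < d := by exact_mod_cast hd
  have hN0 : (0 : ℝ) < N := by exact_mod_cast hd.trans hN
  rw [← Real.log_div hN0.ne' hd0.ne']
  have hk1 : 1 ≤ N / d := (Nat.one_le_div_iff hd).2 hN
  have hu := log_factorial_upper _ hk1
  have hl := log_factorial_lower _ hk1
  have hkx : ((N / d : ℕ) : ℝ) ≤ (N : ℝ) / d := Nat.cast_div_le
  have hxk : (N : ℝ) / d ≤ ((N / d : ℕ) : ℝ) + 1 := by
    rw [div_le_iff₀ hd0]
    have := Nat.lt_mul_div_succ N hd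
    have h' : N ≤ (N / d + 1) * d := by rw [mul_comm]; exact this.le
    exact_mod_cast h'
  have hlogN : Real.log ((N : ℝ) / d) ≤ Real.log N := by
    apply Real.log_le_log (by positivity)
    exact div_le_self hN0.le (by exact_mod_cast hd)
  generalize (N : ℝ) / d = x at *
  generalize hK : N / d = K at *
  have hk : (1 : ℝ) ≤ K := by exact_mod_cast hk1
  generalize (K : ℝ) = k at *
  have hx : 0 < x := by linarith
  have hk0 : 0 < k := by linarith
  have hlk : 0 ≤ Real.log k := Real.log_nonneg hk
  have hlx : Real.log k ≤ Real.log x := Real.log_le_log hk0 hkx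
  have e1 := Real.log_le_sub_one_of_pos (x := x / k) (by positivity)
  have e2 := Real.one_sub_inv_le_log_of_pos (x := x / k) (by positivity)
  rw [Real.log_div hx.ne' hk0.ne'] at e1 e2
  have e3 : k * (Real.log x - Real.log k) ≤ x - k := by
    calc _ ≤ k * (x / k - 1) := by gcongr
      _ = x - k := by field_simp
  have e4 : x - k ≤ x * (Real.log x - Real.log k) := by
    calc x - k = x * (1 - (x / k)⁻¹) := by field_simp
      _ ≤ _ := by gcongr
  constructor
  · nlinarith
  · nlinarith

theorem comb_lower (N : ℕ) (hN : 1680 ≤ N) :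
    0.00466 * (N : ℝ) - 26 * (Real.log N + 1) ≤
    Real.log ((N / 7).factorial : ℝ) - Real.log ((N / 8).factorial : ℝ) - Real.log ((N /
    14).factorial : ℝ) + Real.log ((N / 16).factorial : ℝ) - Real.log ((N / 21).factorial :
    ℝ) + Real.log ((N / 24).factorial : ℝ) - Real.log ((N / 35).factorial : ℝ) + Real.log ((N
    / 40).factorial : ℝ) - Real.log ((N / 48).factorial : ℝ) + Real.log ((N / 56).factorial :
    ℝ) - Real.log ((N / 80).factorial : ℝ) + Real.log ((N / 84).factorial : ℝ) + Real.log ((N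
    / 105).factorial : ℝ) - Real.log ((N / 112).factorial : ℝ) - Real.log ((N /
    120).factorial : ℝ) + 2 * Real.log ((N / 140).factorial : ℝ) - Real.log ((N /
    168).factorial : ℝ) + Real.log ((N / 240).factorial : ℝ) - 2 * Real.log ((N /
    280).factorial : ℝ) + Real.log ((N / 336).factorial : ℝ) + Real.log ((N / 560).factorial
    : ℝ) + 2 * Real.log ((N / 840).factorial : ℝ) - Real.log ((N / 1680).factorial : ℝ) := by
  have s7 := stirling_div N 7 (by norm_num) (by omega)
  have s8 := stirling_div N 8 (by norm_num) (by omega)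
  have l8 : Real.log 8 = 3 * Real.log 2 := by
    rw [show (8 : ℝ) = 2 ^ 3 by norm_num]
    rw [Real.log_pow]
    push_cast
    ring
  have s14 := stirling_div N 14 (by norm_num) (by omega)
  have l14 : Real.log 14 = Real.log 2 + Real.log 7 := by
    rw [show (14 : ℝ) = 2 ^ 1 * 7 ^ 1 by norm_num]
    rw [Real.log_mul (by norm_num) (by norm_num), Real.log_pow, Real.log_pow]
    push_cast
    ring
  have s16 := stirling_div N 16 (by norm_num) (by omega)
  have l16 : Real.log 16 = 4 * Real.log 2 := by
    rw [show (16 : ℝ) = 2 ^ 4 by norm_num]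
    rw [Real.log_pow]
    push_cast
    ring
  have s21 := stirling_div N 21 (by norm_num) (by omega)
  have l21 : Real.log 21 = Real.log 3 + Real.log 7 := by
    rw [show (21 : ℝ) = 3 ^ 1 * 7 ^ 1 by norm_num]
    rw [Real.log_mul (by norm_num) (by norm_num), Real.log_pow, Real.log_pow]
    push_cast
    ring
  have s24 := stirling_div N 24 (by norm_num) (by omega)
  have l24 : Real.log 24 = 3 * Real.log 2 + Real.log 3 := by
    rw [show (24 : ℝ) = 2 ^ 3 * 3 ^ 1 by norm_num]
    rw [Real.log_mul (by norm_num) (by norm_num), Real.log_pow, Real.log_pow]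
    push_cast
    ring
  have s35 := stirling_div N 35 (by norm_num) (by omega)
  have l35 : Real.log 35 = Real.log 5 + Real.log 7 := by
    rw [show (35 : ℝ) = 5 ^ 1 * 7 ^ 1 by norm_num]
    rw [Real.log_mul (by norm_num) (by norm_num), Real.log_pow, Real.log_pow]
    push_cast
    ring
  have s40 := stirling_div N 40 (by norm_num) (by omega)
  have l40 : Real.log 40 = 3 * Real.log 2 + Real.log 5 := by
    rw [show (40 : ℝ) = 2 ^ 3 * 5 ^ 1 by norm_num]
    rw [Real.log_mul (by norm_num) (by norm_num), Real.log_pow, Real.log_pow]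
    push_cast
    ring
  have s48 := stirling_div N 48 (by norm_num) (by omega)
  have l48 : Real.log 48 = 4 * Real.log 2 + Real.log 3 := by
    rw [show (48 : ℝ) = 2 ^ 4 * 3 ^ 1 by norm_num]
    rw [Real.log_mul (by norm_num) (by norm_num), Real.log_pow, Real.log_pow]
    push_cast
    ring
  have s56 := stirling_div N 56 (by norm_num) (by omega)
  have l56 : Real.log 56 = 3 * Real.log 2 + Real.log 7 := by
    rw [show (56 : ℝ) = 2 ^ 3 * 7 ^ 1 by norm_num]
    rw [Real.log_mul (by norm_num) (by norm_num), Real.log_pow, Real.log_pow]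
    push_cast
    ring
  have s80 := stirling_div N 80 (by norm_num) (by omega)
  have l80 : Real.log 80 = 4 * Real.log 2 + Real.log 5 := by
    rw [show (80 : ℝ) = 2 ^ 4 * 5 ^ 1 by norm_num]
    rw [Real.log_mul (by norm_num) (by norm_num), Real.log_pow, Real.log_pow]
    push_cast
    ring
  have s84 := stirling_div N 84 (by norm_num) (by omega)
  have l84 : Real.log 84 = 2 * Real.log 2 + Real.log 3 + Real.log 7 := by
    rw [show (84 : ℝ) = 2 ^ 2 * 3 ^ 1 * 7 ^ 1 by norm_num]
    rw [Real.log_mul (by norm_num) (by norm_num), Real.log_mul (by norm_num) (by norm_num), Real.log_pow, Real.log_pow, Real.log_pow]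
    push_cast
    ring
  have s105 := stirling_div N 105 (by norm_num) (by omega)
  have l105 : Real.log 105 = Real.log 3 + Real.log 5 + Real.log 7 := by
    rw [show (105 : ℝ) = 3 ^ 1 * 5 ^ 1 * 7 ^ 1 by norm_num]
    rw [Real.log_mul (by norm_num) (by norm_num), Real.log_mul (by norm_num) (by norm_num), Real.log_pow, Real.log_pow, Real.log_pow]
    push_cast
    ring
  have s112 := stirling_div N 112 (by norm_num) (by omega)
  have l112 : Real.log 112 = 4 * Real.log 2 + Real.log 7 := by
    rw [show (112 : ℝ) = 2 ^ 4 * 7 ^ 1 by norm_num]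
    rw [Real.log_mul (by norm_num) (by norm_num), Real.log_pow, Real.log_pow]
    push_cast
    ring
  have s120 := stirling_div N 120 (by norm_num) (by omega)
  have l120 : Real.log 120 = 3 * Real.log 2 + Real.log 3 + Real.log 5 := by
    rw [show (120 : ℝ) = 2 ^ 3 * 3 ^ 1 * 5 ^ 1 by norm_num]
    rw [Real.log_mul (by norm_num) (by norm_num), Real.log_mul (by norm_num) (by norm_num), Real.log_pow, Real.log_pow, Real.log_pow]
    push_cast
    ring
  have s140 := stirling_div N 140 (by norm_num) (by omega)
  have l140 : Real.log 140 = 2 * Real.log 2 + Real.log 5 + Real.log 7 := by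
    rw [show (140 : ℝ) = 2 ^ 2 * 5 ^ 1 * 7 ^ 1 by norm_num]
    rw [Real.log_mul (by norm_num) (by norm_num), Real.log_mul (by norm_num) (by norm_num), Real.log_pow, Real.log_pow, Real.log_pow]
    push_cast
    ring
  have s168 := stirling_div N 168 (by norm_num) (by omega)
  have l168 : Real.log 168 = 3 * Real.log 2 + Real.log 3 + Real.log 7 := by
    rw [show (168 : ℝ) = 2 ^ 3 * 3 ^ 1 * 7 ^ 1 by norm_num]
    rw [Real.log_mul (by norm_num) (by norm_num), Real.log_mul (by norm_num) (by norm_num), Real.log_pow, Real.log_pow, Real.log_pow]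
    push_cast
    ring
  have s240 := stirling_div N 240 (by norm_num) (by omega)
  have l240 : Real.log 240 = 4 * Real.log 2 + Real.log 3 + Real.log 5 := by
    rw [show (240 : ℝ) = 2 ^ 4 * 3 ^ 1 * 5 ^ 1 by norm_num]
    rw [Real.log_mul (by norm_num) (by norm_num), Real.log_mul (by norm_num) (by norm_num), Real.log_pow, Real.log_pow, Real.log_pow]
    push_cast
    ring
  have s280 := stirling_div N 280 (by norm_num) (by omega)
  have l280 : Real.log 280 = 3 * Real.log 2 + Real.log 5 + Real.log 7 := by
    rw [show (280 : ℝ) = 2 ^ 3 * 5 ^ 1 * 7 ^ 1 by norm_num]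
    rw [Real.log_mul (by norm_num) (by norm_num), Real.log_mul (by norm_num) (by norm_num), Real.log_pow, Real.log_pow, Real.log_pow]
    push_cast
    ring
  have s336 := stirling_div N 336 (by norm_num) (by omega)
  have l336 : Real.log 336 = 4 * Real.log 2 + Real.log 3 + Real.log 7 := by
    rw [show (336 : ℝ) = 2 ^ 4 * 3 ^ 1 * 7 ^ 1 by norm_num]
    rw [Real.log_mul (by norm_num) (by norm_num), Real.log_mul (by norm_num) (by norm_num), Real.log_pow, Real.log_pow, Real.log_pow]
    push_cast
    ring
  have s560 := stirling_div N 560 (by norm_num) (by omega)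
  have l560 : Real.log 560 = 4 * Real.log 2 + Real.log 5 + Real.log 7 := by
    rw [show (560 : ℝ) = 2 ^ 4 * 5 ^ 1 * 7 ^ 1 by norm_num]
    rw [Real.log_mul (by norm_num) (by norm_num), Real.log_mul (by norm_num) (by norm_num), Real.log_pow, Real.log_pow, Real.log_pow]
    push_cast
    ring
  have s840 := stirling_div N 840 (by norm_num) (by omega)
  have l840 : Real.log 840 = 3 * Real.log 2 + Real.log 3 + Real.log 5 + Real.log 7 := by
    rw [show (840 : ℝ) = 2 ^ 3 * 3 ^ 1 * 5 ^ 1 * 7 ^ 1 by norm_num]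
    rw [Real.log_mul (by norm_num) (by norm_num), Real.log_mul (by norm_num) (by norm_num), Real.log_mul (by norm_num) (by norm_num), Real.log_pow, Real.log_pow, Real.log_pow, Real.log_pow]
    push_cast
    ring
  have s1680 := stirling_div N 1680 (by norm_num) (by omega)
  have l1680 : Real.log 1680 = 4 * Real.log 2 + Real.log 3 + Real.log 5 + Real.log 7 := by
    rw [show (1680 : ℝ) = 2 ^ 4 * 3 ^ 1 * 5 ^ 1 * 7 ^ 1 by norm_num]
    rw [Real.log_mul (by norm_num) (by norm_num), Real.log_mul (by norm_num) (by norm_num), Real.log_mul (by norm_num) (by norm_num), Real.log_pow, Real.log_pow, Real.log_pow, Real.log_pow]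
    push_cast
    ring
  push_cast at s7
  push_cast at s8
  push_cast at s14
  push_cast at s16
  push_cast at s21
  push_cast at s24
  push_cast at s35
  push_cast at s40
  push_cast at s48
  push_cast at s56
  push_cast at s80
  push_cast at s84
  push_cast at s105
  push_cast at s112
  push_cast at s120
  push_cast at s140
  push_cast at s168
  push_cast at s240
  push_cast at s280
  push_cast at s336
  push_cast at s560
  push_cast at s840
  push_cast at s1680
  rw [l8] at s8
  rw [l14] at s14
  rw [l16] at s16
  rw [l21] at s21
  rw [l24] at s24
  rw [l35] at s35
  rw [l40] at s40
  rw [l48] at s48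
  rw [l56] at s56
  rw [l80] at s80
  rw [l84] at s84
  rw [l105] at s105
  rw [l112] at s112
  rw [l120] at s120
  rw [l140] at s140
  rw [l168] at s168
  rw [l240] at s240
  rw [l280] at s280
  rw [l336] at s336
  rw [l560] at s560
  rw [l840] at s840
  rw [l1680] at s1680
  have l7 : 4 * Real.log 7 = 5 * Real.log 2 + Real.log 3 + 2 * Real.log 5
      + Real.log (2401 / 2400) := by
    have h1 : Real.log ((7 : ℝ) ^ 4) = Real.log (2 ^ 5 * 3 * 5 ^ 2 * (2401 / 2400)) := by
      norm_num
    rw [Real.log_mul (by norm_num) (by norm_num), Real.log_mul (by norm_num) (by norm_num),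
      Real.log_mul (by norm_num) (by norm_num), Real.log_pow, Real.log_pow, Real.log_pow] at h1
    push_cast at h1
    exact h1
  have hdel := Real.log_le_sub_one_of_pos (x := (2401 / 2400 : ℝ)) (by norm_num)
  have hkap : (0.00466 : ℝ) ≤ (1/12) * Real.log 2 + (3/280) * Real.log 3 + (-1/30) * Real.log 7 := by
    have := Real.log_two_gt_d9
    have := Real.log_two_lt_d9
    have := Real.log_three_gt_d9
    have := Real.log_three_lt_d9
    have := Real.log_five_lt_d9
    linarith
  have hN0 : (0 : ℝ) ≤ N := Nat.cast_nonneg _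
  have hmul := mul_le_mul_of_nonneg_left hkap hN0
  clear l7 hdel hkap l8 l14 l16 l21 l24 l35 l40 l48 l56 l80 l84 l105 l112 l120 l140 l168 l240 l280 l336 l560 l840 l1680
  replace s7 := s7.1
  replace s8 := s8.2
  replace s14 := s14.2
  replace s16 := s16.1
  replace s21 := s21.2
  replace s24 := s24.1
  replace s35 := s35.2
  replace s40 := s40.1
  replace s48 := s48.2
  replace s56 := s56.1
  replace s80 := s80.2
  replace s84 := s84.1
  replace s105 := s105.1
  replace s112 := s112.2
  replace s120 := s120.2
  replace s140 := s140.1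
  replace s168 := s168.2
  replace s240 := s240.1
  replace s280 := s280.2
  replace s336 := s336.1
  replace s560 := s560.1
  replace s840 := s840.1
  replace s1680 := s1680.2
  linarith

theorem step_prime (n p q : ℕ) (hq : q.Prime) (hpq : 7 * q ≤ 8 * p + 7) (h : p < 7 * n)
    (hno : ¬ ∃ p : ℕ, p.Prime ∧ 7 * n ≤ p ∧ p ≤ 8 * n) : q < 7 * n := by
  by_contra hlt
  exact hno ⟨q, hq, by omega, by omega⟩

theorem small_case (n : ℕ) (hn : 5 ≤ n)
    (hno : ¬ ∃ p : ℕ, p.Prime ∧ 7 * n ≤ p ∧ p ≤ 8 * n) : 17803531 < 7 * n := by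
  have h : 34 < 7 * n := by omega
  replace h := step_prime n _ 37 (by norm_num) (by norm_num) h hno
  replace h := step_prime n _ 43 (by norm_num) (by norm_num) h hno
  replace h := step_prime n _ 47 (by norm_num) (by norm_num) h hno
  replace h := step_prime n _ 53 (by norm_num) (by norm_num) h hno
  replace h := step_prime n _ 61 (by norm_num) (by norm_num) h hno
  replace h := step_prime n _ 67 (by norm_num) (by norm_num) h hno
  replace h := step_prime n _ 73 (by norm_num) (by norm_num) h hno
  replace h := step_prime n _ 83 (by norm_num) (by norm_num) h hno
  replace h := step_prime n _ 89 (by norm_num) (by norm_num) h hno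
  replace h := step_prime n _ 101 (by norm_num) (by norm_num) h hno
  replace h := step_prime n _ 113 (by norm_num) (by norm_num) h hno
  replace h := step_prime n _ 127 (by norm_num) (by norm_num) h hno
  replace h := step_prime n _ 139 (by norm_num) (by norm_num) h hno
  replace h := step_prime n _ 157 (by norm_num) (by norm_num) h hno
  replace h := step_prime n _ 179 (by norm_num) (by norm_num) h hno
  replace h := step_prime n _ 199 (by norm_num) (by norm_num) h hno
  replace h := step_prime n _ 227 (by norm_num) (by norm_num) h hno
  replace h := step_prime n _ 257 (by norm_num) (by norm_num) h hno
  replace h := step_prime n _ 293 (by norm_num) (by norm_num) h hno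
  replace h := step_prime n _ 331 (by norm_num) (by norm_num) h hno
  replace h := step_prime n _ 379 (by norm_num) (by norm_num) h hno
  replace h := step_prime n _ 433 (by norm_num) (by norm_num) h hno
  replace h := step_prime n _ 491 (by norm_num) (by norm_num) h hno
  replace h := step_prime n _ 557 (by norm_num) (by norm_num) h hno
  replace h := step_prime n _ 631 (by norm_num) (by norm_num) h hno
  replace h := step_prime n _ 719 (by norm_num) (by norm_num) h hno
  replace h := step_prime n _ 821 (by norm_num) (by norm_num) h hno
  replace h := step_prime n _ 937 (by norm_num) (by norm_num) h hno
  replace h := step_prime n _ 1069 (by norm_num) (by norm_num) h hno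
  replace h := step_prime n _ 1217 (by norm_num) (by norm_num) h hno
  replace h := step_prime n _ 1381 (by norm_num) (by norm_num) h hno
  replace h := step_prime n _ 1579 (by norm_num) (by norm_num) h hno
  replace h := step_prime n _ 1801 (by norm_num) (by norm_num) h hno
  replace h := step_prime n _ 2053 (by norm_num) (by norm_num) h hno
  replace h := step_prime n _ 2347 (by norm_num) (by norm_num) h hno
  replace h := step_prime n _ 2683 (by norm_num) (by norm_num) h hno
  replace h := step_prime n _ 3067 (by norm_num) (by norm_num) h hno
  replace h := step_prime n _ 3499 (by norm_num) (by norm_num) h hno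
  replace h := step_prime n _ 3989 (by norm_num) (by norm_num) h hno
  replace h := step_prime n _ 4549 (by norm_num) (by norm_num) h hno
  replace h := step_prime n _ 5197 (by norm_num) (by norm_num) h hno
  replace h := step_prime n _ 5939 (by norm_num) (by norm_num) h hno
  replace h := step_prime n _ 6781 (by norm_num) (by norm_num) h hno
  replace h := step_prime n _ 7741 (by norm_num) (by norm_num) h hno
  replace h := step_prime n _ 8839 (by norm_num) (by norm_num) h hno
  replace h := step_prime n _ 10099 (by norm_num) (by norm_num) h hno
  replace h := step_prime n _ 11527 (by norm_num) (by norm_num) h hno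
  replace h := step_prime n _ 13171 (by norm_num) (by norm_num) h hno
  replace h := step_prime n _ 15053 (by norm_num) (by norm_num) h hno
  replace h := step_prime n _ 17203 (by norm_num) (by norm_num) h hno
  replace h := step_prime n _ 19661 (by norm_num) (by norm_num) h hno
  replace h := step_prime n _ 22469 (by norm_num) (by norm_num) h hno
  replace h := step_prime n _ 25679 (by norm_num) (by norm_num) h hno
  replace h := step_prime n _ 29347 (by norm_num) (by norm_num) h hno
  replace h := step_prime n _ 33533 (by norm_num) (by norm_num) h hno
  replace h := step_prime n _ 38321 (by norm_num) (by norm_num) h hno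
  replace h := step_prime n _ 43793 (by norm_num) (by norm_num) h hno
  replace h := step_prime n _ 50047 (by norm_num) (by norm_num) h hno
  replace h := step_prime n _ 57193 (by norm_num) (by norm_num) h hno
  replace h := step_prime n _ 65357 (by norm_num) (by norm_num) h hno
  replace h := step_prime n _ 74687 (by norm_num) (by norm_num) h hno
  replace h := step_prime n _ 85333 (by norm_num) (by norm_num) h hno
  replace h := step_prime n _ 97523 (by norm_num) (by norm_num) h hno
  replace h := step_prime n _ 111443 (by norm_num) (by norm_num) h hno
  replace h := step_prime n _ 127363 (by norm_num) (by norm_num) h hno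
  replace h := step_prime n _ 145549 (by norm_num) (by norm_num) h hno
  replace h := step_prime n _ 166319 (by norm_num) (by norm_num) h hno
  replace h := step_prime n _ 190063 (by norm_num) (by norm_num) h hno
  replace h := step_prime n _ 217207 (by norm_num) (by norm_num) h hno
  replace h := step_prime n _ 248231 (by norm_num) (by norm_num) h hno
  replace h := step_prime n _ 283687 (by norm_num) (by norm_num) h hno
  replace h := step_prime n _ 324211 (by norm_num) (by norm_num) h hno
  replace h := step_prime n _ 370511 (by norm_num) (by norm_num) h hno
  replace h := step_prime n _ 423439 (by norm_num) (by norm_num) h hno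
  replace h := step_prime n _ 483929 (by norm_num) (by norm_num) h hno
  replace h := step_prime n _ 553057 (by norm_num) (by norm_num) h hno
  replace h := step_prime n _ 632053 (by norm_num) (by norm_num) h hno
  replace h := step_prime n _ 722341 (by norm_num) (by norm_num) h hno
  replace h := step_prime n _ 825533 (by norm_num) (by norm_num) h hno
  replace h := step_prime n _ 943429 (by norm_num) (by norm_num) h hno
  replace h := step_prime n _ 1078199 (by norm_num) (by norm_num) h hno
  replace h := step_prime n _ 1232227 (by norm_num) (by norm_num) h hno
  replace h := step_prime n _ 1408241 (by norm_num) (by norm_num) h hno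
  replace h := step_prime n _ 1609417 (by norm_num) (by norm_num) h hno
  replace h := step_prime n _ 1839329 (by norm_num) (by norm_num) h hno
  replace h := step_prime n _ 2102083 (by norm_num) (by norm_num) h hno
  replace h := step_prime n _ 2402381 (by norm_num) (by norm_num) h hno
  replace h := step_prime n _ 2745571 (by norm_num) (by norm_num) h hno
  replace h := step_prime n _ 3137777 (by norm_num) (by norm_num) h hno
  replace h := step_prime n _ 3586021 (by norm_num) (by norm_num) h hno
  replace h := step_prime n _ 4098299 (by norm_num) (by norm_num) h hno
  replace h := step_prime n _ 4683751 (by norm_num) (by norm_num) h hno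
  replace h := step_prime n _ 5352847 (by norm_num) (by norm_num) h hno
  replace h := step_prime n _ 6117491 (by norm_num) (by norm_num) h hno
  replace h := step_prime n _ 6991417 (by norm_num) (by norm_num) h hno
  replace h := step_prime n _ 7990183 (by norm_num) (by norm_num) h hno
  replace h := step_prime n _ 9131611 (by norm_num) (by norm_num) h hno
  replace h := step_prime n _ 10436123 (by norm_num) (by norm_num) h hno
  replace h := step_prime n _ 11926997 (by norm_num) (by norm_num) h hno
  replace h := step_prime n _ 13630831 (by norm_num) (by norm_num) h hno
  replace h := step_prime n _ 15578093 (by norm_num) (by norm_num) h hno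
  replace h := step_prime n _ 17803531 (by norm_num) (by norm_num) h hno
  exact h

theorem psi_sum_bound (n : ℕ) :
    ∑ m ∈ Finset.Ioc 0 (56 * n), ArithmeticFunction.vonMangoldt m * (stepF (56 * n / m) : ℝ) ≤
      (Chebyshev.psi ((8 * n : ℕ) : ℝ) - Chebyshev.psi ((7 * n : ℕ) : ℝ))
        + Chebyshev.psi ((56 * n / 756 : ℕ) : ℝ) := by
  have h1 : Chebyshev.psi ((8 * n : ℕ) : ℝ) - Chebyshev.psi ((7 * n : ℕ) : ℝ) =
      ∑ m ∈ Finset.Ioc (7 * n) (8 * n), ArithmeticFunction.vonMangoldt m := by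
    simp only [Chebyshev.psi, Nat.floor_natCast]
    rw [sub_eq_iff_eq_add', Finset.sum_Ioc_consecutive _ (by omega) (by omega)]
  rw [h1]
  simp only [Chebyshev.psi, Nat.floor_natCast]
  have h2 : Finset.Ioc (7 * n) (8 * n) =
      (Finset.Ioc 0 (56 * n)).filter (fun m => 56 * n / m = 7) := by
    ext m
    simp only [Finset.mem_Ioc, Finset.mem_filter]
    constructor
    · rintro ⟨ha, hb⟩
      refine ⟨by omega, ?_⟩
      rw [Nat.div_eq_iff (by omega)]
      omega
    · rintro ⟨⟨ha, hb⟩, hc⟩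
      rw [Nat.div_eq_iff (by omega)] at hc
      omega
  have h3 : Finset.Ioc 0 (56 * n / 756) =
      (Finset.Ioc 0 (56 * n)).filter (fun m => 756 ≤ 56 * n / m) := by
    ext m
    simp only [Finset.mem_Ioc, Finset.mem_filter]
    constructor
    · rintro ⟨ha, hb⟩
      refine ⟨by omega, ?_⟩
      rw [Nat.le_div_iff_mul_le ha]
      omega
    · rintro ⟨⟨ha, hb⟩, hc⟩
      rw [Nat.le_div_iff_mul_le ha] at hc
      omega
  rw [h2, h3, Finset.sum_filter, Finset.sum_filter, ← Finset.sum_add_distrib]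
  refine Finset.sum_le_sum fun m _ => ?_
  have hL : (0 : ℝ) ≤ ArithmeticFunction.vonMangoldt m :=
    ArithmeticFunction.vonMangoldt_nonneg
  have hF : (stepF (56 * n / m) : ℝ) ≤
      (if 56 * n / m = 7 then 1 else 0) + (if 756 ≤ 56 * n / m then 1 else 0) := by
    exact_mod_cast stepF_le (56 * n / m)
  refine (mul_le_mul_of_nonneg_left hF hL).trans (le_of_eq ?_)
  split_ifs <;> ring

theorem large_case (n : ℕ) (hn : 2000000 ≤ n)
    (hno : ¬ ∃ p : ℕ, p.Prime ∧ 7 * n ≤ p ∧ p ≤ 8 * n) : False := by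
  have hth : Chebyshev.theta ((8 * n : ℕ) : ℝ) = Chebyshev.theta ((7 * n : ℕ) : ℝ) := by
    simp only [Chebyshev.theta, Nat.floor_natCast]
    refine Finset.sum_congr ?_ fun _ _ => rfl
    ext m
    simp only [Finset.mem_filter, Finset.mem_Ioc]
    constructor
    · rintro ⟨⟨ha, hb⟩, hp⟩
      refine ⟨⟨ha, ?_⟩, hp⟩
      by_contra hlt
      exact hno ⟨m, hp, by omega, hb⟩
    · rintro ⟨⟨ha, hb⟩, hp⟩
      exact ⟨⟨ha, by omega⟩, hp⟩
  have hn0 : (2000000 : ℝ) ≤ n := by exact_mod_cast hn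
  have hA := comb_lower (56 * n) (by omega)
  rw [comb_eq] at hA
  have hB := hA.trans (psi_sum_bound n)
  have hC := Chebyshev.theta_le_psi ((7 * n : ℕ) : ℝ)
  have hD := Chebyshev.psi_sub_theta_le (x := ((8 * n : ℕ) : ℝ)) (by push_cast; linarith)
  have hE : Chebyshev.psi ((56 * n / 756 : ℕ) : ℝ) ≤ Chebyshev.psi ((56 * n : ℝ) / 756) := by
    apply Chebyshev.psi_mono
    have := Nat.cast_div_le (α := ℝ) (m := 56 * n) (n := 756)
    push_cast at this
    exact this
  have hF := Chebyshev.psi_le (x := (56 * n : ℝ) / 756) (by linarith)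
  push_cast at *
  -- compare everything with `s = √n`
  obtain ⟨s, hs0, hs⟩ : ∃ s : ℝ, 0 < s ∧ (n : ℝ) = s ^ 2 :=
    ⟨√n, Real.sqrt_pos.2 (by linarith), (Real.sq_sqrt (by linarith)).symm⟩
  rw [hs] at hn0 hB hD hF hE hth hC
  have hs1 : 1400 ≤ s := by nlinarith
  have l2 := Real.log_two_lt_d9
  have l4 : Real.log 4 = 2 * Real.log 2 := by
    rw [show (4 : ℝ) = 2 ^ 2 by norm_num, Real.log_pow]; norm_num
  have ls : Real.log s ≤ s / 2048 - 1 + 11 * Real.log 2 := by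
    have h := Real.log_le_sub_one_of_pos (x := s / 2048) (by positivity)
    rw [Real.log_div (by positivity) (by norm_num),
      show (2048 : ℝ) = 2 ^ 11 by norm_num, Real.log_pow] at h
    push_cast at h
    norm_num at h ⊢
    linarith
  have l64 : Real.log (64 * s ^ 2) = 6 * Real.log 2 + 2 * Real.log s := by
    rw [Real.log_mul (by norm_num) (by positivity), Real.log_pow,
      show (64 : ℝ) = 2 ^ 6 by norm_num, Real.log_pow]
    norm_num
  have b56 : Real.log (56 * s ^ 2) ≤ s / 1024 + 18 := by
    have : Real.log (56 * s ^ 2) ≤ Real.log (64 * s ^ 2) :=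
      Real.log_le_log (by positivity) (by nlinarith)
    linarith
  have b8 : Real.log (8 * s ^ 2) ≤ s / 1024 + 15.4 := by
    rw [Real.log_mul (by norm_num) (by positivity), Real.log_pow,
      show (8 : ℝ) = 2 ^ 3 by norm_num, Real.log_pow]
    push_cast
    linarith
  have b1 : Real.log (56 * s ^ 2 / 756) ≤ s / 1024 + 15.4 := by
    refine (Real.log_le_log (by positivity) ?_).trans b8
    nlinarith
  have r8 : √(8 * s ^ 2) ≤ 2.83 * s := by
    apply Real.sqrt_le_iff.2
    constructor
    · positivity
    · nlinarith
  have r1 : √(56 * s ^ 2 / 756) ≤ 0.3 * s := by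
    apply Real.sqrt_le_iff.2
    constructor
    · positivity
    · nlinarith
  have p8 : 0 ≤ Real.log (8 * s ^ 2) := Real.log_nonneg (by nlinarith)
  have p1 : 0 ≤ Real.log (56 * s ^ 2 / 756) := Real.log_nonneg (by nlinarith)
  have t8 : 2 * √(8 * s ^ 2) * Real.log (8 * s ^ 2) ≤ 2 * (2.83 * s) * (s / 1024 + 15.4) := by
    gcongr
  have t1 : 2 * √(56 * s ^ 2 / 756) * Real.log (56 * s ^ 2 / 756) ≤
      2 * (0.3 * s) * (s / 1024 + 15.4) := by
    gcongr
  have t4 : Real.log 4 * (56 * s ^ 2 / 756) ≤ 1.38630 * (56 * s ^ 2 / 756) := by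
    gcongr
    linarith
  have fin : 0.00466 * (56 * s ^ 2) - 26 * (s / 1024 + 18 + 1) ≤
      2 * (2.83 * s) * (s / 1024 + 15.4) + 1.38630 * (56 * s ^ 2 / 756)
        + 2 * (0.3 * s) * (s / 1024 + 15.4) := by
    linarith
  nlinarith

theorem exists_prime_in_Icc_seven_eight (n : ℕ) (hn : 0 < n) (hn2 : n ≠ 2) :
    ∃ p : ℕ, p.Prime ∧ 7 * n ≤ p ∧ p ≤ 8 * n := by
  by_contra hno
  have h5 : 5 ≤ n := by
    by_contra hlt
    have : n = 1 ∨ n = 3 ∨ n = 4 := by omega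
    rcases this with rfl | rfl | rfl
    · exact hno ⟨7, by norm_num, by norm_num, by norm_num⟩
    · exact hno ⟨23, by norm_num, by norm_num, by norm_num⟩
    · exact hno ⟨29, by norm_num, by norm_num, by norm_num⟩
  have h := small_case n h5 hno
  exact large_case n (by omega) hno
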